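/- If P is a v-partition, then the complement [ω]^ω \ ∪P of the union of P is a v⁰-set. -/

import Mathlib

open Set

/-- `A`, `B` form a segment when `A ⊆ B` and `B \ A` is infinite. -/
def IsSeg (A B : Set ℕ) : Prop := A ⊆ B ∧ (B \ A).Infinite

/-- The segment `⟨A,B⟩ = {X ∈ [ω]^ω : A ⊆ X ⊆ B}`. -/
def Seg (A B : Set ℕ) : Set (Set ℕ) := {X | X.Infinite ∧ A ⊆ X ∧ X ⊆ B}

/-- `X ⊆* Y` : the set `X \ Y` is finite. -/
def AlmostSub (X Y : Set ℕ) : Prop := (X \ Y).Finite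

/-- The *-segment `⟨A,B⟩* = {X ∈ [ω]^ω : A ⊆* X ⊆* B}`. -/
def StarSeg (A B : Set ℕ) : Set (Set ℕ) := {X | X.Infinite ∧ AlmostSub A X ∧ AlmostSub X B}

/-- `S` is a v⁰-set: every segment contains a segment disjoint from `S`. -/
def IsVZero (S : Set (Set ℕ)) : Prop :=
  ∀ A B, IsSeg A B → ∃ C D, IsSeg C D ∧ Seg C D ⊆ Seg A B ∧ Seg C D ∩ S = ∅

/-- `S` is a v-set: every segment contains a segment inside `S` or disjoint from `S`. -/
def IsVSet (S : Set (Set ℕ)) : Prop :=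
  ∀ A B, IsSeg A B → ∃ C D, IsSeg C D ∧ Seg C D ⊆ Seg A B ∧
    (Seg C D ⊆ S ∨ Seg C D ∩ S = ∅)

/-- A set of infinite subsets of `ℕ` is a *-segment if it is of the form `⟨A,B⟩*`. -/
def IsStarSeg (P : Set (Set ℕ)) : Prop := ∃ A B, IsSeg A B ∧ P = StarSeg A B

/-- Two *-segments are *-disjoint when their intersection is countable. -/
def StarDisjoint (P Q : Set (Set ℕ)) : Prop := (P ∩ Q).Countable

/-- A v-partition: a maximal family of pairwise *-disjoint *-segments. -/
def IsVPartition (P : Set (Set (Set ℕ))) : Prop :=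
  (∀ X ∈ P, IsStarSeg X) ∧
  (∀ X ∈ P, ∀ Y ∈ P, X ≠ Y → StarDisjoint X Y) ∧
  (∀ R, IsStarSeg R → R ∉ P → ∃ X ∈ P, ¬ StarDisjoint R X)

/-- `P` refines `Q`: every member of `P` is contained in some member of `Q`. -/
def Refines (P Q : Set (Set (Set ℕ))) : Prop := ∀ X ∈ P, ∃ Y ∈ Q, X ⊆ Y

/-- A v-matrix is a collection of v-partitions. -/
def IsVMatrix (H : Set (Set (Set (Set ℕ)))) : Prop := ∀ P ∈ H, IsVPartition P

/-- A v-matrix `H` is shattering: for every *-segment `⟨A,B⟩*` some partition in `H`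
has two distinct members whose intersections with `⟨A,B⟩*` are two different *-segments. -/
def Shattering (H : Set (Set (Set (Set ℕ)))) : Prop :=
  IsVMatrix H ∧ ∀ A B, IsSeg A B → ∃ P ∈ H, ∃ X ∈ P, ∃ Y ∈ P, X ≠ Y ∧
    IsStarSeg (X ∩ StarSeg A B) ∧ IsStarSeg (Y ∩ StarSeg A B) ∧
    X ∩ StarSeg A B ≠ Y ∩ StarSeg A B

/-- `κ(v)`: the least cardinality of a shattering v-matrix. -/
noncomputable def kappaV : Cardinal :=
  sInf {c : Cardinal | ∃ H : Set (Set (Set (Set ℕ))), Shattering H ∧ Cardinal.mk ↥H = c}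

/-- The sets at finite distance from a fixed set of natural numbers form a countable family. -/
lemma countable_setOf_finite_sdiff (E : Set ℕ) :
    {Y : Set ℕ | (E \ Y).Finite ∧ (Y \ E).Finite}.Countable := by
  have hc : {t : Set ℕ | t.Finite}.Countable := by
    simpa using countable_ofPred_finite_subset (countable_univ (α := ℕ))
  refine (hc.image (fun t => symmDiff E t)).mono ?_
  rintro Y ⟨h₁, h₂⟩
  exact ⟨symmDiff E Y, h₁.union h₂, symmDiff_symmDiff_cancel_left E Y⟩

/-- If two *-segments meet in an uncountable set, then their common part contains infinitely many
free coordinates. -/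
lemma infinite_inter_sdiff_union_of_not_starDisjoint {A B A' B' : Set ℕ}
    (h : ¬ StarDisjoint (StarSeg A B) (StarSeg A' B')) :
    ((B ∩ B') \ (A ∪ A')).Infinite := by
  intro hfin
  refine h ((countable_setOf_finite_sdiff (A ∪ A')).mono ?_)
  rintro Y ⟨⟨-, hAY, hYB⟩, -, hAY', hYB'⟩
  refine ⟨(hAY.union hAY').subset ?_, ((hYB.union hYB').union hfin).subset ?_⟩
  · rintro x ⟨hx | hx, hxY⟩
    · exact Or.inl ⟨hx, hxY⟩
    · exact Or.inr ⟨hx, hxY⟩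
  · rintro x ⟨hxY, hx⟩
    by_cases hB : x ∈ B
    · by_cases hB' : x ∈ B'
      · exact Or.inr ⟨⟨hB, hB'⟩, hx⟩
      · exact Or.inl (Or.inr ⟨hxY, hB'⟩)
    · exact Or.inl (Or.inl ⟨hxY, hB⟩)

lemma AlmostSub.trans {X Y Z : Set ℕ} (h₁ : AlmostSub X Y) (h₂ : AlmostSub Y Z) :
    AlmostSub X Z :=
  (h₁.union h₂).subset (sdiff_triangle X Y Z)

lemma seg_subset_starSeg (A B : Set ℕ) : Seg A B ⊆ StarSeg A B := by
  rintro Y ⟨hY, hA, hB⟩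
  refine ⟨hY, ?_, ?_⟩
  · simp [AlmostSub, sdiff_eq_empty.mpr hA]
  · simp [AlmostSub, sdiff_eq_empty.mpr hB]

/-- A segment whose *-segment is not *-disjoint from another *-segment contains a segment inside
the latter. -/
lemma exists_seg_subset_of_not_starDisjoint {A B A' B' : Set ℕ} (hAB : IsSeg A B)
    (hAB' : IsSeg A' B') (h : ¬ StarDisjoint (StarSeg A B) (StarSeg A' B')) :
    ∃ C D, IsSeg C D ∧ Seg C D ⊆ Seg A B ∧ Seg C D ⊆ StarSeg A' B' := by
  obtain ⟨Y, ⟨-, hAY, hYB⟩, -, hAY', hYB'⟩ : (StarSeg A B ∩ StarSeg A' B').Nonempty := by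
    by_contra hne
    exact h (by simp [StarDisjoint, not_nonempty_iff_eq_empty.mp hne])
  have hA'B : AlmostSub A' B := hAY'.trans hYB
  have hAB'' : AlmostSub A B' := hAY.trans hYB'
  have hCD : A ∪ (A' ∩ B) ⊆ A ∪ (B ∩ B') :=
    union_subset_union_right _ fun x hx => ⟨hx.2, hAB'.1 hx.1⟩
  refine ⟨A ∪ (A' ∩ B), A ∪ (B ∩ B'), ⟨hCD, ?_⟩, ?_, ?_⟩
  · refine (infinite_inter_sdiff_union_of_not_starDisjoint h).mono ?_
    rintro x ⟨hx, hn⟩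
    exact ⟨Or.inr hx, fun hc => hn (hc.imp id And.left)⟩
  · rintro Z ⟨hZ, hCZ, hZD⟩
    exact ⟨hZ, subset_union_left.trans hCZ,
      hZD.trans (union_subset hAB.1 inter_subset_left)⟩
  · rintro Z ⟨hZ, hCZ, hZD⟩
    refine ⟨hZ, hA'B.subset ?_, hAB''.subset ?_⟩
    · exact fun x hx => ⟨hx.1, fun hB => hx.2 (hCZ (Or.inr ⟨hx.1, hB⟩))⟩
    · exact fun x hx => ⟨(hZD hx.1).resolve_right fun hc => hx.2 hc.2, hx.2⟩

/-- Lemma 13: the complement of the union of a v-partition is a v⁰-set. -/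
theorem compl_sUnion_vPartition_isVZero (P : Set (Set (Set ℕ))) (hP : IsVPartition P) :
    IsVZero ({X : Set ℕ | X.Infinite} \ ⋃₀ P) := by
  obtain ⟨hstar, -, hmax⟩ := hP
  intro A B hAB
  obtain ⟨C, D, hCD, hsub, X, hX, hCX⟩ :
      ∃ C D, IsSeg C D ∧ Seg C D ⊆ Seg A B ∧ ∃ X ∈ P, Seg C D ⊆ X := by
    by_cases hR : StarSeg A B ∈ P
    · exact ⟨A, B, hAB, Subset.rfl, _, hR, seg_subset_starSeg A B⟩
    · obtain ⟨X, hX, hnd⟩ := hmax _ ⟨A, B, hAB, rfl⟩ hR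
      obtain ⟨A', B', hAB', rfl⟩ := hstar X hX
      obtain ⟨C, D, hCD, hsub, hCX⟩ := exists_seg_subset_of_not_starDisjoint hAB hAB' hnd
      exact ⟨C, D, hCD, hsub, _, hX, hCX⟩
  refine ⟨C, D, hCD, hsub, eq_empty_of_forall_notMem ?_⟩
  rintro Y ⟨hY, -, hn⟩
  exact hn ⟨X, hX, hCX hY⟩
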